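/- For every odd n ≥ 5, the tournament U_n has a unique vertex of in-degree 1, namely v_{(n-1)/2}, and the unique in-neighbor of this vertex is v_n. -/

import Mathlib

/-- The tournament `T_n` on vertices `v_1, ..., v_n` (vertex `v_{i+1}` is the
index `i : Fin n`): `v_i → v_j` iff `j - i ≡ 1, ..., (n-1)/2 (mod n)`. -/
def tnRel (n : ℕ) (i j : Fin n) : Prop :=
  1 ≤ (j.val + n - i.val) % n ∧ (j.val + n - i.val) % n ≤ (n - 1) / 2

/-- `U_n` is obtained from `T_n` by reversing all arcs with both ends in
`{v_1, ..., v_{(n-1)/2}}` (i.e. indices `< (n-1)/2`). -/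
def unRel (n : ℕ) (i j : Fin n) : Prop :=
  if i.val < (n - 1) / 2 ∧ j.val < (n - 1) / 2 then tnRel n j i else tnRel n i j

/-- The arcs of `T_n`, without modular arithmetic. -/
theorem tnRel_iff {n : ℕ} (i j : Fin n) :
    tnRel n i j ↔ (i.val < j.val ∧ j.val ≤ i.val + (n - 1) / 2) ∨
      (j.val < i.val ∧ j.val + n ≤ i.val + (n - 1) / 2) := by
  have hi := i.isLt
  have hj := j.isLt
  unfold tnRel
  rcases lt_or_ge j.val i.val with h | h
  · rw [Nat.mod_eq_of_lt (by omega)]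
    omega
  · rw [show j.val + n - i.val = (j.val - i.val) + n by omega, Nat.add_mod_right,
      Nat.mod_eq_of_lt (by omega)]
    omega

/-- The arcs of `U_n`, without modular arithmetic. -/
theorem unRel_iff {n : ℕ} (i j : Fin n) :
    unRel n i j ↔
      if i.val < (n - 1) / 2 ∧ j.val < (n - 1) / 2 then j.val < i.val
      else (i.val < j.val ∧ j.val ≤ i.val + (n - 1) / 2) ∨
        (j.val < i.val ∧ j.val + n ≤ i.val + (n - 1) / 2) := by
  have hi := i.isLt
  have hj := j.isLt
  unfold unRel
  split_ifs <;> rw [tnRel_iff]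
  omega

/-- Every vertex of `U_n` other than `v_{(n-1)/2}` has two distinct in-neighbours. -/
theorem exists_two_inNeighbors {n : ℕ} (h5 : 5 ≤ n) (v : Fin n)
    (hv : v.val ≠ (n - 1) / 2 - 1) :
    ∃ a b : Fin n, unRel n a v ∧ unRel n b v ∧ a ≠ b := by
  have hlt := v.isLt
  simp only [unRel_iff, ne_eq, Fin.ext_iff]
  rcases lt_or_ge v.val ((n - 1) / 2) with h | h
  · refine ⟨⟨n - 1, by omega⟩, ⟨(n - 1) / 2 - 1, by omega⟩, ?_, ?_, ?_⟩ <;>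
      dsimp only <;> (try split_ifs) <;> omega
  · refine ⟨⟨v.val - 1, by omega⟩, ⟨v.val - 2, by omega⟩, ?_, ?_, ?_⟩ <;>
      dsimp only <;> (try split_ifs) <;> omega

/-- For odd `n ≥ 5`, `v_{(n-1)/2}` is the unique vertex of `U_n` of in-degree 1,
and its unique in-neighbour is `v_n`. -/
theorem un_unique_indegree_one (n : ℕ) (hn : Odd n) (h5 : 5 ≤ n) :
    (∀ v : Fin n,
      ({u : Fin n | unRel n u v}).ncard = 1 ↔ v = ⟨(n - 1) / 2 - 1, by omega⟩) ∧
    (∀ u : Fin n, unRel n u ⟨(n - 1) / 2 - 1, by omega⟩ ↔ u = ⟨n - 1, by omega⟩) := by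
  have key : ∀ u : Fin n,
      unRel n u ⟨(n - 1) / 2 - 1, by omega⟩ ↔ u = ⟨n - 1, by omega⟩ := by
    intro u
    have hu := u.isLt
    obtain ⟨m, rfl⟩ := hn
    rw [unRel_iff, Fin.ext_iff]
    dsimp only
    split_ifs <;> omega
  refine ⟨fun v => ⟨fun h => ?_, ?_⟩, key⟩
  · by_contra hv
    obtain ⟨a, b, ha, hb, hab⟩ := exists_two_inNeighbors h5 v (fun e => hv (Fin.ext e))
    obtain ⟨c, hc⟩ := Set.ncard_eq_one.mp h
    have ha' : a ∈ ({c} : Set (Fin n)) := hc ▸ ha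
    have hb' : b ∈ ({c} : Set (Fin n)) := hc ▸ hb
    exact hab (ha'.trans hb'.symm)
  · rintro rfl
    exact Set.ncard_eq_one.mpr ⟨⟨n - 1, by omega⟩, Set.ext key⟩
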